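/- (Exact trace formula for polynomial observables) Let N ≥ 3, let M be any matrix of the uni-modular ensemble with phases Φ, W = M/(2√(N−2)), and y_n(Φ) = Tr[Y(Φ)^n]/(N (N−2)^{n/2}). Let f be a real polynomial of degree d, and let f_n = ((2 − δ_{n,0})/π) ∫_{−1}^{1} f(ε) T_n(ε)/√(1−ε²) dε be its Chebyshev coefficients (so f_n = 0 for n > d). Then, for every realization of the phases, (1/N) Tr[f(W)] = (1/2) Σ_{n=3}^{d} f_n y_n(Φ) + ∫_{−1}^{1} f(ε) · (2/π)√(1−ε²) / (1 + 1/(N−2) − 4ε²/(N−1)) dε. -/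

import Mathlib

open MeasureTheory Matrix

noncomputable section

/-- The uniform probability measure on `[0, 2π)`. -/
def uniformPhase : Measure ℝ :=
  (ENNReal.ofReal (2 * Real.pi))⁻¹ • volume.restrict (Set.Ico 0 (2 * Real.pi))

/-- Product measure: the phases `ω μ ν` (used for `μ < ν`) are i.i.d. uniform on `[0, 2π)`. -/
def phaseMeasure (N : ℕ) : Measure (Fin N → Fin N → ℝ) :=
  Measure.pi fun _ => Measure.pi fun _ => uniformPhase

/-- Antisymmetrized phases built from a raw sample: `φ ν μ = - φ μ ν`, `φ μ μ = 0`. -/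
def phases (N : ℕ) (ω : Fin N → Fin N → ℝ) : Fin N → Fin N → ℝ :=
  fun μ ν => if μ < ν then ω μ ν else if ν < μ then - (ω ν μ) else 0

/-- The uni-modular matrix with phases `φ`: zero diagonal, `M μ ν = exp(i φ μ ν)` off diagonal. -/
def umeMatrix (N : ℕ) (φ : Fin N → Fin N → ℝ) : Matrix (Fin N) (Fin N) ℂ :=
  fun μ ν => if μ = ν then 0 else Complex.exp (Complex.I * (φ μ ν : ℂ))


/-- A directed edge of the complete graph on `N` vertices: a pair `e = (j, i)` with `i ≠ j`;
its origin is `e.2` and its terminus is `e.1`. -/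
abbrev DirEdge (N : ℕ) : Type := {e : Fin N × Fin N // e.1 ≠ e.2}

/-- The magnetic Hashimoto matrix of the complete graph on `N` vertices with phases `φ`:
`Y(Φ)_{e',e} = (δ_{o(e'),τ(e)} − δ_{e',ê}) · exp((i/2)(φ_e + φ_{e'}))`. -/
def hashimoto (N : ℕ) (φ : Fin N → Fin N → ℝ) :
    Matrix (DirEdge N) (DirEdge N) ℂ :=
  fun e' e =>
    (((if e'.1.2 = e.1.1 then 1 else 0) : ℂ) - ((if e'.1 = (e.1.2, e.1.1) then 1 else 0) : ℂ)) *
      Complex.exp (Complex.I / 2 * ((φ e.1.1 e.1.2 : ℂ) + (φ e'.1.1 e'.1.2 : ℂ)))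


/-- The scaled UME matrix `W = M / (2√(N−2))`. -/
def scaledUme (N : ℕ) (φ : Fin N → Fin N → ℝ) : Matrix (Fin N) (Fin N) ℂ :=
  ((1 / (2 * Real.sqrt ((N : ℝ) - 2)) : ℝ) : ℂ) • umeMatrix N φ

/-- `Tr[T_n(W)]`, the trace of the `n`-th Chebyshev polynomial of the first kind evaluated
at the scaled UME matrix `W = M/(2√(N−2))`. -/
def chebTrace (N : ℕ) (φ : Fin N → Fin N → ℝ) (n : ℕ) : ℂ :=
  Matrix.trace (Polynomial.aeval (scaledUme N φ) (Polynomial.Chebyshev.T ℂ n))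

/-- The `n`-th Chebyshev coefficient of a real polynomial `f`:
`f_n = ((2 − δ_{n,0})/π) ∫_{−1}^{1} f(ε) T_n(ε)/√(1−ε²) dε`. -/
def chebCoeff (f : Polynomial ℝ) (n : ℕ) : ℝ :=
  (2 - if n = 0 then 1 else 0) / Real.pi *
    ∫ ε in (-1 : ℝ)..1,
      f.eval ε * (Polynomial.Chebyshev.T ℝ n).eval ε / Real.sqrt (1 - ε ^ 2)

open Complex in
def mQ (N : ℕ) (φ : Fin N → Fin N → ℝ) : Matrix (DirEdge N) (Fin N) ℂ :=
  fun e v => if e.1.2 = v then Complex.exp (Complex.I / 2 * (φ e.1.1 e.1.2 : ℂ)) else 0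

def mP (N : ℕ) (φ : Fin N → Fin N → ℝ) : Matrix (Fin N) (DirEdge N) ℂ :=
  fun v e => if e.1.1 = v then Complex.exp (Complex.I / 2 * (φ e.1.1 e.1.2 : ℂ)) else 0

def mJ (N : ℕ) : Matrix (DirEdge N) (DirEdge N) ℂ :=
  fun e' e => if e'.1 = (e.1.2, e.1.1) then 1 else 0

lemma sum_dirEdge {N : ℕ} (g : Fin N → Fin N → ℂ) :
    ∑ e : DirEdge N, g e.1.1 e.1.2 = ∑ a, ∑ b, if a = b then 0 else g a b := by
  rw [← Finset.sum_subtype (Finset.univ.filter fun e : Fin N × Fin N => e.1 ≠ e.2)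
    (by simp) (fun e => g e.1 e.2), Finset.sum_filter, Fintype.sum_prod_type]
  simp

def flipE {N : ℕ} (e : DirEdge N) : DirEdge N := ⟨(e.1.2, e.1.1), e.2.symm⟩

lemma mJ_apply {N : ℕ} (e' e : DirEdge N) : mJ N e' e = if e = flipE e' then 1 else 0 := by
  rcases e with ⟨⟨a, b⟩, h⟩
  rcases e' with ⟨⟨c, d⟩, h'⟩
  simp only [mJ, flipE, Prod.mk.injEq, Subtype.mk.injEq]
  congr 1
  grind

lemma mJ_mul {N : ℕ} {ι : Type*} (A : Matrix (DirEdge N) ι ℂ) (e : DirEdge N) (i : ι) :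
    (mJ N * A) e i = A (flipE e) i := by
  simp [Matrix.mul_apply, mJ_apply]

lemma mJ_sq (N : ℕ) : mJ N * mJ N = 1 := by
  ext a b
  rw [mJ_mul, mJ_apply, Matrix.one_apply]
  simp only [flipE, Prod.mk.eta, Subtype.coe_eta]
  simp [eq_comm]

lemma trace_mJ (N : ℕ) : (mJ N).trace = 0 := by
  rw [Matrix.trace]
  apply Finset.sum_eq_zero
  intro e _
  rw [Matrix.diag_apply, mJ_apply, if_neg]
  intro h
  have := congrArg (fun x : DirEdge N => x.1.1) h
  exact e.2 this

lemma mP_mul_mQ {N : ℕ} (φ : Fin N → Fin N → ℝ) : mP N φ * mQ N φ = umeMatrix N φ := by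
  ext u v
  rw [Matrix.mul_apply]
  simp only [mP, mQ]
  rw [sum_dirEdge (fun a b => (if a = u then Complex.exp (Complex.I / 2 * (φ a b : ℂ)) else 0) *
    (if b = v then Complex.exp (Complex.I / 2 * (φ a b : ℂ)) else 0))]
  rw [Finset.sum_eq_single u, Finset.sum_eq_single v]
  · simp only [umeMatrix, if_true]
    split_ifs
    · rfl
    · rw [← Complex.exp_add]; congr 1; ring
  · intro b _ hb; simp [hb]
  · simp
  · intro b _ hb; simp [hb]
  · simp

lemma mP_mJ_mQ {N : ℕ} (φ : Fin N → Fin N → ℝ) (hφ : ∀ μ ν, φ ν μ = - φ μ ν) :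
    mP N φ * (mJ N * mQ N φ) = ((N : ℂ) - 1) • (1 : Matrix (Fin N) (Fin N) ℂ) := by
  ext u v
  rw [Matrix.mul_apply]
  simp only [mJ_mul]
  refine Eq.trans ?_ (Eq.trans (sum_dirEdge (fun a b => (if a = u then Complex.exp (Complex.I / 2 * (φ a b : ℂ)) else 0) *
    (if a = v then Complex.exp (Complex.I / 2 * (φ b a : ℂ)) else 0))) ?_)
  · rfl
  rw [Finset.sum_eq_single u]
  · have h : ∀ b, Complex.exp (Complex.I / 2 * (φ u b : ℂ)) *
        Complex.exp (Complex.I / 2 * (φ b u : ℂ)) = 1 := by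
      intro b
      rw [← Complex.exp_add, hφ u b]
      push_cast
      rw [← mul_add]; simp
    by_cases huv : u = v
    · subst huv
      simp only [if_true, h]
      have : ∀ x : Fin N, (if u = x then (0:ℂ) else 1) = 1 - if u = x then 1 else 0 := by
        intro x; split_ifs <;> simp
      simp [this]
    · simp [huv]
  · intro b _ hb; simp [hb]
  · simp

lemma hashimoto_eq {N : ℕ} (φ : Fin N → Fin N → ℝ) (hφ : ∀ μ ν, φ ν μ = - φ μ ν) :
    hashimoto N φ = mQ N φ * mP N φ - mJ N := by
  ext e' e
  rw [Matrix.sub_apply, Matrix.mul_apply]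
  simp only [mQ, mP, hashimoto, mJ]
  simp only [ite_mul, zero_mul, Finset.sum_ite_eq, Finset.mem_univ, if_true]
  rcases e with ⟨⟨a, b⟩, h⟩
  rcases e' with ⟨⟨c, d⟩, h'⟩
  simp only [Prod.mk.injEq]
  by_cases h1 : c = b ∧ d = a
  · obtain ⟨rfl, rfl⟩ := h1
    have : (φ d c : ℂ) + φ c d = 0 := by rw [hφ c d]; push_cast; ring
    simp only [this, if_true, and_self]
    rw [← Complex.exp_add, ← mul_add, add_comm (φ c d : ℂ), this]
    simp
  · rw [if_neg h1, sub_zero, sub_zero]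
    by_cases h2 : d = a
    · subst h2
      simp only [if_true, one_mul]
      rw [← Complex.exp_add]; congr 1; ring
    · have h3 : a ≠ d := fun h => h2 h.symm
      simp [h2, h3]

lemma trace_ume_sq {N : ℕ} (φ : Fin N → Fin N → ℝ) (hφ : ∀ μ ν, φ ν μ = - φ μ ν) :
    (umeMatrix N φ * umeMatrix N φ).trace = (N : ℂ) * (N - 1) := by
  rw [Matrix.trace]
  have : ∀ u, (umeMatrix N φ * umeMatrix N φ).diag u = (N : ℂ) - 1 := by
    intro u
    rw [Matrix.diag_apply, Matrix.mul_apply]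
    have : ∀ x : Fin N, umeMatrix N φ u x * umeMatrix N φ x u = 1 - if u = x then 1 else 0 := by
      intro x
      simp only [umeMatrix]
      by_cases h : u = x
      · simp [h]
      · have h' : x ≠ u := fun h' => h h'.symm
        rw [if_neg h, if_neg h', if_neg h, ← Complex.exp_add, hφ u x]
        push_cast
        rw [← mul_add]; simp
    simp [this]
  simp only [this]
  simp
  ring

lemma trace_ume {N : ℕ} (φ : Fin N → Fin N → ℝ) : (umeMatrix N φ).trace = 0 := by
  simp [Matrix.trace, umeMatrix]

/-- Trace of powers of the Hashimoto matrix. -/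
lemma trace_hash {N : ℕ} (φ : Fin N → Fin N → ℝ) (hφ : ∀ μ ν, φ ν μ = - φ μ ν)
    (p : ℕ → Matrix (Fin N) (Fin N) ℂ) (h0 : p 0 = (2 : ℂ) • 1) (h1 : p 1 = umeMatrix N φ)
    (h2 : ∀ n, p (n + 2) = p (n + 1) * umeMatrix N φ - ((N : ℂ) - 2) • p n) (n : ℕ) :
    (hashimoto N φ ^ (n + 1)).trace = (p (n + 1)).trace + (N : ℂ) * (N - 3) / 2 *
      (1 + (-1) ^ (n + 1)) := by
  set Y := hashimoto N φ with hY
  set Q := mQ N φ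
  set P := mP N φ
  set J := mJ N
  set M := umeMatrix N φ with hM
  have hYe : Y = Q * P - J := hashimoto_eq φ hφ
  have hPQ : P * Q = M := mP_mul_mQ φ
  have hPJQ : P * (J * Q) = ((N : ℂ) - 1) • 1 := mP_mJ_mQ φ hφ
  have hJJ : J * J = 1 := mJ_sq N
  have hYQ : Y * Q = Q * M - J * Q := by
    rw [hYe, Matrix.sub_mul, Matrix.mul_assoc, hPQ]
  have hYJQ : Y * (J * Q) = ((N : ℂ) - 2) • Q := by
    rw [hYe, Matrix.sub_mul, Matrix.mul_assoc, hPJQ, ← Matrix.mul_assoc J J, hJJ, Matrix.one_mul,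
      Matrix.mul_smul, Matrix.mul_one]
    module
  set X : ℕ → Matrix (Fin N) (Fin N) ℂ := fun n => P * (Y ^ n * Q) with hX
  set Z : ℕ → Matrix (Fin N) (Fin N) ℂ := fun n => P * (Y ^ n * (J * Q)) with hZ
  have hZ0 : Z 0 = ((N : ℂ) - 1) • 1 := by simp [hZ, hPJQ]
  have hZs : ∀ n, Z (n + 1) = ((N : ℂ) - 2) • X n := by
    intro n
    simp only [hZ, hX, pow_succ, Matrix.mul_assoc, hYJQ, Matrix.mul_smul]
  have hX0 : X 0 = M := by simp [hX, hPQ]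
  have hXs : ∀ n, X (n + 1) = X n * M - Z n := by
    intro n
    simp only [hX, hZ, pow_succ, Matrix.mul_assoc, hYQ, Matrix.mul_sub]
  have hX1 : X 1 = M * M - ((N : ℂ) - 1) • 1 := by rw [hXs 0, hX0, hZ0]
  have hXr : ∀ n, X (n + 2) = X (n + 1) * M - ((N : ℂ) - 2) • X n := by
    intro n; rw [hXs, hZs]
  -- trace recursion
  have ht : ∀ n, (Y ^ (n + 2)).trace = (X (n + 1)).trace - (Z n).trace + (Y ^ n).trace := by
    intro n
    have e1 : Y ^ (n + 2) = Y ^ (n + 1) * Q * P - Y ^ (n + 1) * J := by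
      rw [Matrix.mul_assoc, ← mul_sub, ← hYe, ← pow_succ]
    have e2 : J * Y ^ (n + 1) = (J * Q) * (P * Y ^ n) - Y ^ n := by
      rw [pow_succ', ← mul_assoc]
      nth_rewrite 1 [hYe]
      rw [mul_sub, hJJ, sub_mul, one_mul, ← Matrix.mul_assoc J Q P, Matrix.mul_assoc]
    rw [e1, Matrix.trace_sub, Matrix.trace_mul_comm _ J, e2, Matrix.trace_sub,
      Matrix.trace_mul_comm (J * Q), Matrix.trace_mul_comm _ P]
    simp only [hX, hZ, Matrix.mul_assoc]
    ring
  have hp2 : p 2 = M * M - (((N : ℂ) - 2) * 2) • 1 := by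
    rw [h2 0, h1, h0, smul_smul]
  have key : ∀ n, X (n + 2) - ((N : ℂ) - 2) • X n = p (n + 3) - p (n + 1) := by
    intro n
    induction n using Nat.twoStepInduction with
    | zero =>
      rw [hXr, h2 1, hp2, h1, hX0, hX1]
      simp only [Matrix.sub_mul, Matrix.smul_mul, Matrix.one_mul]
      module
    | one =>
      rw [hXr 1, h2 2, h2 1, hXr 0, hp2, h1, hX0, hX1]
      simp only [Matrix.sub_mul, Matrix.smul_mul, Matrix.one_mul]
      module
    | more n ih1 ih2 =>
      have a1 : X (n + 4) = X (n + 3) * M - ((N : ℂ) - 2) • X (n + 2) := hXr (n + 2)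
      have a2 : X (n + 2) = X (n + 1) * M - ((N : ℂ) - 2) • X n := hXr n
      have a3 : p (n + 5) = p (n + 4) * M - ((N : ℂ) - 2) • p (n + 3) := h2 (n + 3)
      have a4 : p (n + 3) = p (n + 2) * M - ((N : ℂ) - 2) • p (n + 1) := h2 (n + 1)
      have ih2' := congrArg (fun A => A * M) ih2
      simp only [Matrix.sub_mul, Matrix.smul_mul] at ih2'
      change X (n + 3) * M - ((N : ℂ) - 2) • (X (n + 1) * M)
        = p (n + 4) * M - p (n + 2) * M at ih2'
      change X (n + 4) - ((N : ℂ) - 2) • X (n + 2) = p (n + 5) - p (n + 3)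
      linear_combination (norm := skip) a1 - ((N : ℂ) - 2) • a2 - a3 + a4 + ih2' - ((N : ℂ) - 2) • ih1
      module
  have tM : M.trace = 0 := trace_ume φ
  have tM2 : (M * M).trace = (N : ℂ) * (N - 1) := trace_ume_sq φ hφ
  have tr1 : (1 : Matrix (Fin N) (Fin N) ℂ).trace = N := by simp
  induction n using Nat.twoStepInduction with
  | zero =>
    simp only [zero_add, pow_one, h1, tM]
    rw [hYe, Matrix.trace_sub, Matrix.trace_mul_comm, hPQ, tM, trace_mJ]
    ring
  | one =>
    rw [ht 0, hX1, hZ0, hp2]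
    simp only [pow_zero, Matrix.trace_sub, Matrix.trace_smul, tM2, tr1, smul_eq_mul]
    have : (1 : Matrix (DirEdge N) (DirEdge N) ℂ).trace = (N : ℂ) * (N - 1) := by
      have := sum_dirEdge (N := N) (fun _ _ => 1)
      have h' : ∀ u x : Fin N, (if u = x then (0:ℂ) else 1) = 1 - if u = x then 1 else 0 := by
        intro u x; split_ifs <;> simp
      simp only [h', Finset.sum_sub_distrib] at this
      rw [Matrix.trace]
      simp only [Matrix.diag_apply, Matrix.one_apply_eq]
      rw [this]
      simp
      ring
    rw [this]
    ring
  | more n ih1 ih2 =>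
    have k := congrArg Matrix.trace (key n)
    rw [Matrix.trace_sub, Matrix.trace_sub, ← hZs] at k
    rw [show n + 2 + 1 = n + 1 + 2 from rfl, ht (n + 1), ih1]
    rw [show n + 1 + 2 = n + 3 from rfl]
    linear_combination k

open Polynomial Polynomial.Chebyshev in
lemma contraction_zero (q B : ℝ) (hq : 1 < q) (b : ℕ → ℝ) (hB : ∀ n, |b n| ≤ B)
    (hb : ∀ n, ∃ i j, (q ^ 2 + 1) * b n = q * (b i + b j)) (n : ℕ) : b n = 0 := by
  set c := 2 * q / (q ^ 2 + 1) with hc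
  have hpos : 0 < q ^ 2 + 1 := by positivity
  have hc0 : 0 ≤ c := by positivity
  have hc1 : c < 1 := by
    rw [hc, div_lt_one hpos]; nlinarith [sq_pos_of_pos (sub_pos.2 hq)]
  have hk : ∀ k n, |b n| ≤ c ^ k * B := by
    intro k
    induction k with
    | zero => simpa using hB
    | succ k ih =>
      intro n
      obtain ⟨i, j, h⟩ := hb n
      have e : b n = q * (b i + b j) / (q ^ 2 + 1) := by
        rw [eq_div_iff hpos.ne']; linarith
      rw [e, abs_div, abs_mul, abs_of_pos hpos, abs_of_pos (by linarith : 0 < q), div_le_iff₀ hpos]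
      have h3 : c * (q ^ 2 + 1) = 2 * q := by rw [hc]; field_simp
      calc q * |b i + b j| ≤ q * (c ^ k * B + c ^ k * B) := by
            gcongr
            exact (abs_add_le _ _).trans (add_le_add (ih i) (ih j))
        _ = c ^ k * B * (c * (q ^ 2 + 1)) := by rw [h3]; ring
        _ = _ := by ring
  have hl : Filter.Tendsto (fun k => c ^ k * B) Filter.atTop (nhds 0) := by
    simpa using (tendsto_pow_atTop_nhds_zero_of_lt_one hc0 hc1).mul_const B
  have : |b n| ≤ 0 := ge_of_tendsto' hl (fun k => hk k n)
  exact abs_nonpos_iff.1 this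

/-- Chebyshev moments of the limiting density. -/
def kmMom (q : ℝ) (n : ℕ) : ℝ :=
  if n = 0 then 1 else -((q - 1) / 4) * (1 + (-1) ^ n) / Real.sqrt q ^ n

open Polynomial Polynomial.Chebyshev in
lemma T_four_sq (m : ℤ) (x : ℝ) : 4 * x ^ 2 * (T ℝ m).eval x =
    (T ℝ (m + 2)).eval x + 2 * (T ℝ m).eval x + (T ℝ (m - 2)).eval x := by
  have h := congrArg (Polynomial.eval x) (T_mul_T ℝ m 2)
  simp only [eval_mul, eval_add, T_two, eval_sub, eval_pow, eval_X, eval_one, eval_ofNat] at h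
  linear_combination h

open Polynomial Polynomial.Chebyshev in
lemma km_rec (q : ℝ) (h : ℝ → ℝ) (hc : ContinuousOn h (Set.Icc (-1) 1))
    (he : ∀ x ∈ Set.Icc (-1 : ℝ) 1, h x * ((q + 1) ^ 2 - 4 * q * x ^ 2) =
      2 / Real.pi * (q * (q + 1)) * (1 - x ^ 2)) (m : ℤ) :
    (q ^ 2 + 1) * ∫ x, (T ℝ m).eval x * h x ∂measureT =
      q * ((∫ x, (T ℝ (m + 2)).eval x * h x ∂measureT) +
        ∫ x, (T ℝ (m - 2)).eval x * h x ∂measureT) +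
      q * (q + 1) / (2 * Real.pi) * (2 * (∫ x, (T ℝ m).eval x ∂measureT)
        - (∫ x, (T ℝ (m + 2)).eval x ∂measureT) - ∫ x, (T ℝ (m - 2)).eval x ∂measureT) := by
  have i1 : ∀ k : ℤ, Integrable (fun x => (T ℝ k).eval x * h x) measureT := fun k =>
    integrable_measureT (ContinuousOn.mul (by fun_prop) hc)
  have i2 : ∀ k : ℤ, Integrable (fun x => (T ℝ k).eval x) measureT := fun k =>
    integrable_measureT (by fun_prop)
  have i3 : Integrable (fun x => (T ℝ (m + 2)).eval x * h x + (T ℝ (m - 2)).eval x * h x)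
      measureT := (i1 _).add (i1 _)
  have i4 : Integrable (fun x => 2 * (T ℝ m).eval x - (T ℝ (m + 2)).eval x) measureT :=
    ((i2 _).const_mul _).sub (i2 _)
  have i5 : Integrable (fun x => 2 * (T ℝ m).eval x - (T ℝ (m + 2)).eval x
      - (T ℝ (m - 2)).eval x) measureT := i4.sub (i2 _)
  rw [← integral_add (i1 _) (i1 _), ← integral_const_mul, ← integral_const_mul (2 : ℝ),
    ← integral_sub ((i2 _).const_mul _) (i2 _), ← integral_sub i4 (i2 _),
    ← integral_const_mul, ← integral_const_mul, ← integral_add (i3.const_mul _) (i5.const_mul _),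
    integral_measureT, integral_measureT]
  refine intervalIntegral.integral_congr ?_
  intro x hx
  rw [Set.uIcc_of_le (by norm_num)] at hx
  have e1 := he x hx
  have e2 := T_four_sq m x
  have hpi := Real.pi_ne_zero
  have e3 : q * (q + 1) / (2 * Real.pi) * 4 = 2 / Real.pi * (q * (q + 1)) := by
    field_simp; norm_num
  simp only
  congr 1
  linear_combination (T ℝ m).eval x * e1 + q * h x * e2 - q * (q + 1) / (2 * Real.pi) * e2
    - (1 - x ^ 2) * (T ℝ m).eval x * e3

open Polynomial Polynomial.Chebyshev in
lemma tau_val (m : ℤ) : ∫ x, (T ℝ m).eval x ∂measureT = if m = 0 then Real.pi else 0 := by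
  split_ifs with h
  · rw [h]; exact integral_eval_T_real_measureT_zero
  · exact integral_eval_T_real_measureT_of_ne_zero h

open Polynomial Polynomial.Chebyshev in
lemma km_moment (q : ℝ) (hq : 1 < q) (h : ℝ → ℝ) (hc : ContinuousOn h (Set.Icc (-1) 1))
    (he : ∀ x ∈ Set.Icc (-1 : ℝ) 1, h x * ((q + 1) ^ 2 - 4 * q * x ^ 2) =
      2 / Real.pi * (q * (q + 1)) * (1 - x ^ 2)) (n : ℕ) :
    ∫ x, (T ℝ n).eval x * h x ∂measureT = kmMom q n := by
  set K : ℤ → ℝ := fun m => ∫ x, (T ℝ m).eval x * h x ∂measureT with hK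
  have hKneg : ∀ m, K (-m) = K m := by intro m; simp [hK, T_neg]
  have hr : ∀ m, (q ^ 2 + 1) * K m = q * (K (m + 2) + K (m - 2)) +
      q * (q + 1) / (2 * Real.pi) * (2 * (if m = 0 then Real.pi else 0)
        - (if m + 2 = 0 then Real.pi else 0) - (if m - 2 = 0 then Real.pi else 0)) := by
    intro m
    have := km_rec q h hc he m
    simpa only [tau_val] using this
  have hpi := Real.pi_ne_zero
  have hq0 : 0 < q := by linarith
  set s := Real.sqrt q with hs
  have hs2 : s ^ 2 = q := Real.sq_sqrt hq0.le
  have hs0 : 0 < s := Real.sqrt_pos.2 hq0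
  have hs1 : 1 ≤ s := by
    rw [hs]; exact Real.one_le_sqrt.2 hq.le
  suffices H : ∀ n : ℕ, K n - kmMom q n = 0 by exact sub_eq_zero.1 (H n)
  -- boundedness
  obtain ⟨B, hB⟩ : ∃ B, ∀ n : ℕ, |K n| ≤ B := by
    refine ⟨∫ x, |h x| ∂measureT, fun n => ?_⟩
    rw [hK]
    simp only
    rw [← Real.norm_eq_abs]
    refine (norm_integral_le_integral_norm _).trans ?_
    rw [integral_measureT, integral_measureT]
    have j1 : IntervalIntegrable (fun x => ‖(T ℝ n).eval x * h x‖ * √(1 - x ^ 2)⁻¹) volume (-1) 1 := by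
      refine intervalIntegrable_sqrt_one_sub_sq_inv.continuousOn_mul ?_
      rw [Set.uIcc_of_le (by norm_num)]
      exact (ContinuousOn.mul (by fun_prop) hc).norm
    have j2 : IntervalIntegrable (fun x => |h x| * √(1 - x ^ 2)⁻¹) volume (-1) 1 := by
      refine intervalIntegrable_sqrt_one_sub_sq_inv.continuousOn_mul ?_
      rw [Set.uIcc_of_le (by norm_num)]
      exact hc.abs
    refine intervalIntegral.integral_mono_on (by norm_num) j1 j2 ?_
    intro x hx
    rw [Real.norm_eq_abs, abs_mul]
    have hT : |(T ℝ n).eval x| ≤ 1 := by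
      rw [← Real.cos_arccos hx.1 hx.2]
      rw [T_real_cos]
      exact Real.abs_cos_le_one _
    have : 0 ≤ √(1 - x ^ 2)⁻¹ := Real.sqrt_nonneg _
    gcongr
    nlinarith [abs_nonneg (h x)]
  have hE : ∀ n, |kmMom q n| ≤ 1 + (q - 1) := by
    intro n
    unfold kmMom
    split_ifs
    · simp; linarith
    · rw [abs_div, abs_mul, abs_neg, abs_of_nonneg (by linarith : 0 ≤ (q - 1) / 4)]
      rw [div_le_iff₀ (by positivity), ← hs, abs_of_nonneg (by positivity : 0 ≤ s ^ n)]
      have h1 : 1 ≤ s ^ n := one_le_pow₀ hs1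
      have h2 : |1 + (-1 : ℝ) ^ n| ≤ 2 := by
        rcases neg_one_pow_eq_or ℝ n with h | h <;> rw [h] <;> norm_num
      have h3 : (q - 1) / 4 * |1 + (-1 : ℝ) ^ n| ≤ (q - 1) / 4 * 2 := by gcongr
      nlinarith
  intro n
  refine contraction_zero q (B + (1 + (q - 1))) hq (fun n => K n - kmMom q n) ?_ ?_ n
  · intro n
    exact (abs_sub _ _).trans (add_le_add (hB n) (hE n))
  · intro n
    have two : ∀ n, kmMom q (n + 1) = -((q - 1) / 4) * (1 + (-1) ^ (n + 1)) / s ^ (n + 1) := by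
      intro n; simp [kmMom, hs]
    match n with
    | 0 =>
      refine ⟨2, 2, ?_⟩
      have := hr 0
      have hn := hKneg 2
      norm_num at this
      rw [show (-2 : ℤ) = -2 from rfl, hn] at this
      have e0 : kmMom q 0 = 1 := by simp [kmMom]
      have e2 : kmMom q 2 = -((q - 1) / 2) / q := by
        rw [two 1, ← hs2]; norm_num; ring
      simp only [e0, e2, Nat.cast_zero, Nat.cast_ofNat]
      field_simp at this ⊢
      linarith
    | 1 =>
      refine ⟨3, 1, ?_⟩
      have := hr 1
      have hn := hKneg 1
      norm_num at this
      rw [hn] at this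
      have e0 : kmMom q 1 = 0 := by rw [two 0]; norm_num
      have e2 : kmMom q 3 = 0 := by rw [two 2]; norm_num
      simp only [e0, e2, Nat.cast_one, Nat.cast_ofNat]
      linarith
    | 2 =>
      refine ⟨4, 0, ?_⟩
      have := hr 2
      norm_num at this
      have e0 : kmMom q 0 = 1 := by simp [kmMom]
      have e2 : kmMom q 2 = -((q - 1) / 2) / q := by
        rw [two 1, ← hs2]; norm_num; ring
      have e4 : kmMom q 4 = -((q - 1) / 2) / q ^ 2 := by
        rw [two 3, ← hs2]; norm_num; ring
      simp only [e0, e2, e4, Nat.cast_zero, Nat.cast_ofNat]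
      field_simp at this ⊢
      linear_combination q * this
    | n + 3 =>
      refine ⟨n + 5, n + 1, ?_⟩
      have := hr (n + 3)
      rw [if_neg (by omega), if_neg (by omega), if_neg (by omega)] at this
      have c1 : (n : ℤ) + 3 + 2 = ((n + 5 : ℕ) : ℤ) := by push_cast; ring
      have c2 : (n : ℤ) + 3 - 2 = ((n + 1 : ℕ) : ℤ) := by push_cast; ring
      have c3 : (n : ℤ) + 3 = ((n + 3 : ℕ) : ℤ) := by push_cast; ring
      rw [c1, c2, c3] at this
      have e : (q ^ 2 + 1) * kmMom q (n + 3) = q * (kmMom q (n + 5) + kmMom q (n + 1)) := by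
        rw [two (n + 4), two (n + 2), two n]
        rw [← hs2]
        field_simp
        ring
      linear_combination this - e

open Polynomial Polynomial.Chebyshev in
lemma km_exists (q : ℝ) (hq : 1 ≤ q) : ∃ h : ℝ → ℝ, ContinuousOn h (Set.Icc (-1) 1) ∧
    (∀ x ∈ Set.Icc (-1 : ℝ) 1, (2 / Real.pi) * Real.sqrt (1 - x ^ 2)
      / (1 + 1 / q - 4 * x ^ 2 / (q + 1)) = h x * √(1 - x ^ 2)⁻¹) ∧
    ∀ n : ℕ, ∫ x, (T ℝ n).eval x * h x ∂measureT = kmMom q n := by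
  have hpi := Real.pi_pos
  rcases hq.eq_or_lt with rfl | hq
  · refine ⟨fun _ => 1 / Real.pi, continuousOn_const, ?_, ?_⟩
    · intro x hx
      have hx2 : 0 ≤ 1 - x ^ 2 := by nlinarith [hx.1, hx.2]
      rcases hx2.eq_or_lt with h0 | h0
      · rw [← h0]; simp
      · rw [Real.sqrt_inv]
        have hs := Real.sqrt_pos.2 h0
        have hss := Real.sq_sqrt hx2
        rw [show (1 + 1 / 1 - 4 * x ^ 2 / (1 + 1) : ℝ) = 2 * (√(1 - x ^ 2)) ^ 2 by
          rw [hss]; ring]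
        field_simp
    · intro n
      rw [integral_mul_const, tau_val]
      by_cases hn : n = 0
      · simp [hn, kmMom]
      · simp [hn, kmMom]
  · have hq0 : 0 < q := by linarith
    have hD : ∀ x ∈ Set.Icc (-1 : ℝ) 1, 0 < (q + 1) ^ 2 - 4 * q * x ^ 2 := by
      intro x hx
      have hx2 : x ^ 2 ≤ 1 := by nlinarith [hx.1, hx.2]
      nlinarith [sq_pos_of_pos (sub_pos.2 hq)]
    set h : ℝ → ℝ := fun x => 2 / Real.pi * (q * (q + 1)) * (1 - x ^ 2) /
      ((q + 1) ^ 2 - 4 * q * x ^ 2) with hh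
    have hc : ContinuousOn h (Set.Icc (-1) 1) := by
      refine ContinuousOn.div (by fun_prop) (by fun_prop) ?_
      intro x hx; exact (hD x hx).ne'
    refine ⟨h, hc, ?_, ?_⟩
    · intro x hx
      have hx2 : 0 ≤ 1 - x ^ 2 := by nlinarith [hx.1, hx.2]
      rcases hx2.eq_or_lt with h0 | h0
      · rw [← h0]; simp
      · rw [Real.sqrt_inv, hh]
        simp only
        have hs := Real.sqrt_pos.2 h0
        have hss := Real.sq_sqrt hx2
        have hDx := hD x hx
        rw [show (1 + 1 / q - 4 * x ^ 2 / (q + 1) : ℝ) =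
          ((q + 1) ^ 2 - 4 * q * x ^ 2) / (q * (q + 1)) by field_simp]
        nth_rewrite 2 [← hss]
        field_simp
    · intro n
      refine km_moment q hq h hc ?_ n
      intro x hx
      exact div_mul_cancel₀ _ (hD x hx).ne'

open Polynomial Polynomial.Chebyshev in
lemma cheb_expand (d : ℕ) : ∀ f : Polynomial ℝ, f.natDegree ≤ d →
    ∃ a : ℕ → ℝ, f = ∑ m ∈ Finset.range (d + 1), Polynomial.C (a m) * T ℝ m := by
  induction d with
  | zero =>
    intro f hf
    refine ⟨fun _ => f.coeff 0, ?_⟩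
    simpa using Polynomial.eq_C_of_natDegree_le_zero hf
  | succ d ih =>
    intro f hf
    set c := f.coeff (d + 1) / (T ℝ ((d + 1 : ℕ) : ℤ)).leadingCoeff with hc
    have hT0 : T ℝ ((d + 1 : ℕ) : ℤ) ≠ 0 := by
      intro h; have := degree_T ℝ ((d + 1 : ℕ) : ℤ); rw [h] at this; simp at this
    have hTd : (T ℝ ((d + 1 : ℕ) : ℤ)).natDegree = d + 1 := by rw [natDegree_T, Int.natAbs_natCast]
    have hdeg : (f - Polynomial.C c * T ℝ ((d + 1 : ℕ) : ℤ)).natDegree ≤ d := by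
      rw [Polynomial.natDegree_le_iff_coeff_eq_zero]
      intro k hk
      rw [coeff_sub, coeff_C_mul]
      rcases (Nat.succ_le_of_lt hk).eq_or_lt with h | h
      · rw [← h]
        have : (T ℝ ((d + 1 : ℕ) : ℤ)).coeff (d + 1) = (T ℝ ((d + 1 : ℕ) : ℤ)).leadingCoeff := by
          rw [leadingCoeff, hTd]
        rw [Nat.succ_eq_add_one, this, hc, div_mul_cancel₀ _ (leadingCoeff_ne_zero.2 hT0), sub_self]
      · rw [coeff_eq_zero_of_natDegree_lt (by omega), coeff_eq_zero_of_natDegree_lt (by omega)]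
        simp
    obtain ⟨a, ha⟩ := ih _ hdeg
    refine ⟨fun m => if m = d + 1 then c else a m, ?_⟩
    rw [Finset.sum_range_succ]
    simp only [if_true]
    rw [Finset.sum_congr rfl (g := fun m : ℕ => Polynomial.C (a m) * T ℝ m)]
    · rw [← ha]; ring
    · intro m hm
      rw [if_neg]
      have := Finset.mem_range.1 hm
      omega

open Polynomial Polynomial.Chebyshev in
lemma chebCoeff_expand (d : ℕ) (a : ℕ → ℝ) (n : ℕ) (hn : n ≠ 0) (hnd : n ≤ d) :
    chebCoeff (∑ m ∈ Finset.range (d + 1), Polynomial.C (a m) * T ℝ m) n = a n := by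
  have hpi := Real.pi_ne_zero
  set f := ∑ m ∈ Finset.range (d + 1), Polynomial.C (a m) * T ℝ (m : ℤ) with hf
  have h1 : ∫ ε in (-1 : ℝ)..1, f.eval ε * (T ℝ n).eval ε / Real.sqrt (1 - ε ^ 2)
      = ∫ x, f.eval x * (T ℝ n).eval x ∂measureT := by
    rw [integral_measureT]
    congr 1
    ext x
    rw [Real.sqrt_inv, div_eq_mul_inv]
  have h2 : ∫ x, f.eval x * (T ℝ n).eval x ∂measureT = a n * (Real.pi / 2) := by
    have : ∀ x, f.eval x * (T ℝ n).eval x =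
        ∑ m ∈ Finset.range (d + 1), a m * ((T ℝ m).eval x * (T ℝ n).eval x) := by
      intro x
      rw [hf, eval_finsetSum, Finset.sum_mul]
      refine Finset.sum_congr rfl fun m _ => ?_
      rw [eval_mul, eval_C]; ring
    simp only [this]
    rw [integral_finsetSum]
    · simp only [integral_const_mul]
      rw [Finset.sum_eq_single n]
      · rw [integral_T_real_mul_self_measureT_of_ne_zero hn]
      · intro b _ hb
        rw [integral_eval_T_real_mul_eval_T_real_measureT_of_ne hb, mul_zero]
      · intro h; exact absurd (Finset.mem_range.2 (by omega)) h
    · intro i _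
      exact integrable_measureT (by fun_prop)
  rw [chebCoeff, h1, h2, if_neg hn]
  field_simp
  ring

open Polynomial Polynomial.Chebyshev in
lemma cheb_trace (N : ℕ) (hN : 3 ≤ N) (φ : Fin N → Fin N → ℝ)
    (hφ : ∀ μ ν, φ ν μ = - φ μ ν) (n : ℕ) :
    (1 / (N : ℂ)) * Matrix.trace (Polynomial.aeval (scaledUme N φ) (T ℝ ((n + 1 : ℕ) : ℤ))) =
     (1 / 2) * (Matrix.trace ((hashimoto N φ) ^ (n + 1))
            / ((N : ℂ) * ((Real.sqrt ((N : ℝ) - 2) : ℂ)) ^ (n + 1)))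
      + (kmMom ((N : ℝ) - 2) (n + 1) : ℂ) := by
  have hN' : (3 : ℝ) ≤ N := by exact_mod_cast hN
  set s : ℝ := Real.sqrt ((N : ℝ) - 2) with hs
  have hs0 : 0 < s := Real.sqrt_pos.2 (by linarith)
  have hs2 : (s : ℂ) ^ 2 = (N : ℂ) - 2 := by
    rw [← Complex.ofReal_pow, hs, Real.sq_sqrt (by linarith)]; push_cast; ring
  have hsc : (s : ℂ) ≠ 0 := by exact_mod_cast hs0.ne'
  have hNc : (N : ℂ) ≠ 0 := by
    have : (N : ℝ) ≠ 0 := by linarith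
    exact_mod_cast this
  set W := scaledUme N φ with hW
  have hMW : umeMatrix N φ = (2 * (s : ℂ)) • W := by
    rw [hW, scaledUme, smul_smul, ← hs]
    push_cast
    rw [mul_one_div_cancel (by simpa using hsc), one_smul]
  have key := trace_hash φ hφ (fun n => (2 * (s : ℂ) ^ n) • Polynomial.aeval W (T ℝ (n : ℤ)))
    (by simp) (by simp [hMW]) (by
      intro n
      have : aeval W (T ℝ ((n + 2 : ℕ) : ℤ)) =
          (2 : ℂ) • (aeval W (T ℝ ((n + 1 : ℕ) : ℤ)) * W) - aeval W (T ℝ (n : ℤ)) := by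
        push_cast
        rw [T_add_two, show (2 : ℝ[X]) * X * T ℝ ((n : ℤ) + 1) = T ℝ ((n : ℤ) + 1) * X +
          T ℝ ((n : ℤ) + 1) * X by ring]
        simp only [map_sub, map_add, map_mul, aeval_X]
        module
      rw [this, hMW, ← hs2]
      simp only [Matrix.smul_mul, Matrix.mul_smul, smul_sub, smul_smul]
      congr 2 <;> ring) n
  simp only [Matrix.trace_smul, smul_eq_mul] at key
  rw [key, kmMom, if_neg (by omega), ← hs]
  push_cast
  have hsn : (s : ℂ) ^ (n + 1) ≠ 0 := pow_ne_zero _ hsc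
  field_simp
  ring

theorem cheb_trace_small (N : ℕ) (φ : Fin N → Fin N → ℝ)
    (hφ : ∀ μ ν, φ ν μ = - φ μ ν) (n : ℕ) (hn : n = 1 ∨ n = 2) :
    Matrix.trace ((hashimoto N φ) ^ n) = 0 := by
  let p : ℕ → Matrix (Fin N) (Fin N) ℂ × Matrix (Fin N) (Fin N) ℂ := fun n =>
    Nat.rec ((2 : ℂ) • 1, umeMatrix N φ)
      (fun _ x => (x.2, x.2 * umeMatrix N φ - ((N : ℂ) - 2) • x.1)) n
  have key := trace_hash φ hφ (fun n => (p n).1) rfl rfl (fun n => rfl)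
  rcases hn with rfl | rfl
  · have := key 0
    rw [zero_add] at this
    rw [this, show (p 1).1 = umeMatrix N φ from rfl, trace_ume]
    norm_num
  · have := key 1
    rw [show 1 + 1 = 2 from rfl] at this
    rw [this, show (p 2).1 = umeMatrix N φ * umeMatrix N φ - ((N : ℂ) - 2) • ((2 : ℂ) • 1) from rfl,
      Matrix.trace_sub, trace_ume_sq φ hφ, Matrix.trace_smul, Matrix.trace_smul, Matrix.trace_one]
    simp only [smul_eq_mul, Fintype.card_fin]
    ring

/-- exact trace formula for polynomial observables: for `N ≥ 3`, any matrix of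
the UME with antisymmetric phases `Φ`, `W = M/(2√(N−2))`,
`y_n(Φ) = Tr[Y(Φ)^n]/(N(N−2)^{n/2})`, and any real polynomial `f` of degree `d`,
`(1/N)·Tr[f(W)] = (1/2)·Σ_{n=3}^{d} f_n y_n(Φ)
  + ∫_{−1}^{1} f(ε)·(2/π)√(1−ε²)/(1 + 1/(N−2) − 4ε²/(N−1)) dε`. -/
theorem ume_exact_trace_formula (N : ℕ) (hN : 3 ≤ N) (φ : Fin N → Fin N → ℝ)
    (hφ : ∀ μ ν, φ ν μ = - φ μ ν) (f : Polynomial ℝ) (d : ℕ) (hd : f.natDegree = d) :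
    (1 / (N : ℂ)) * Matrix.trace (Polynomial.aeval (scaledUme N φ) f)
      = (1 / 2) * ∑ n ∈ Finset.Icc 3 d, (chebCoeff f n : ℂ) *
          (Matrix.trace ((hashimoto N φ) ^ n)
            / ((N : ℂ) * ((Real.sqrt ((N : ℝ) - 2) : ℂ)) ^ n))
        + ((∫ ε in (-1 : ℝ)..1,
              f.eval ε * ((2 / Real.pi) * Real.sqrt (1 - ε ^ 2)
                / (1 + 1 / ((N : ℝ) - 2) - 4 * ε ^ 2 / ((N : ℝ) - 1))) : ℝ) : ℂ) := by
  have hN' : (3 : ℝ) ≤ N := by exact_mod_cast hN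
  have hNc : (N : ℂ) ≠ 0 := by
    have : (N : ℝ) ≠ 0 := by linarith
    exact_mod_cast this
  obtain ⟨h, hc, hh, hm⟩ := km_exists ((N : ℝ) - 2) (by linarith)
  obtain ⟨a, ha⟩ := cheb_expand d f hd.le
  -- the smooth part
  have hsmooth : ∫ ε in (-1 : ℝ)..1, f.eval ε * ((2 / Real.pi) * Real.sqrt (1 - ε ^ 2)
                / (1 + 1 / ((N : ℝ) - 2) - 4 * ε ^ 2 / ((N : ℝ) - 1)))
      = ∑ m ∈ Finset.range (d + 1), a m * kmMom ((N : ℝ) - 2) m := by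
    have e1 : ∫ ε in (-1 : ℝ)..1, f.eval ε * ((2 / Real.pi) * Real.sqrt (1 - ε ^ 2)
                / (1 + 1 / ((N : ℝ) - 2) - 4 * ε ^ 2 / ((N : ℝ) - 1)))
        = ∫ x, f.eval x * h x ∂Polynomial.Chebyshev.measureT := by
      rw [Polynomial.Chebyshev.integral_measureT]
      refine intervalIntegral.integral_congr ?_
      intro x hx
      rw [Set.uIcc_of_le (by norm_num)] at hx
      have := hh x hx
      rw [show (N : ℝ) - 2 + 1 = N - 1 by ring] at this
      simp only
      rw [this, mul_assoc]
    rw [e1]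
    have e2 : ∀ x, f.eval x * h x = ∑ m ∈ Finset.range (d + 1),
        a m * ((Polynomial.Chebyshev.T ℝ m).eval x * h x) := by
      intro x
      rw [ha, Polynomial.eval_finsetSum, Finset.sum_mul]
      refine Finset.sum_congr rfl fun m _ => ?_
      rw [Polynomial.eval_mul, Polynomial.eval_C]; ring
    simp only [e2]
    rw [integral_finsetSum]
    · simp only [integral_const_mul, hm]
    · intro i _
      refine Integrable.const_mul ?_ _
      exact Polynomial.Chebyshev.integrable_measureT (ContinuousOn.mul (by fun_prop) hc)
  -- the fluctuating part
  have hfl : ∑ n ∈ Finset.Icc 3 d, (chebCoeff f n : ℂ) *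
          (Matrix.trace ((hashimoto N φ) ^ n)
            / ((N : ℂ) * ((Real.sqrt ((N : ℝ) - 2) : ℂ)) ^ n))
      = ∑ n ∈ Finset.range (d + 1), if n = 0 then 0 else (a n : ℂ) *
          (Matrix.trace ((hashimoto N φ) ^ n)
            / ((N : ℂ) * ((Real.sqrt ((N : ℝ) - 2) : ℂ)) ^ n)) := by
    refine Eq.trans (Finset.sum_congr rfl ?_) (Finset.sum_subset (s₁ := Finset.Icc 3 d) ?_ ?_)
    · intro n hn
      rw [Finset.mem_Icc] at hn
      rw [if_neg (by omega), ha, chebCoeff_expand d a n (by omega) hn.2]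
    · intro n hn
      rw [Finset.mem_Icc] at hn
      rw [Finset.mem_range]; omega
    · intro n hn hn'
      rw [Finset.mem_range] at hn
      rw [Finset.mem_Icc] at hn'
      split_ifs with h0
      · rfl
      · rw [cheb_trace_small N φ hφ n (by omega)]; simp
  rw [hsmooth, hfl]
  have hL : Matrix.trace (Polynomial.aeval (scaledUme N φ) f) =
      ∑ m ∈ Finset.range (d + 1), (a m : ℂ) *
        Matrix.trace (Polynomial.aeval (scaledUme N φ) (Polynomial.Chebyshev.T ℝ m)) := by
    rw [ha, map_sum, Matrix.trace_sum]
    refine Finset.sum_congr rfl fun m _ => ?_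
    rw [← Polynomial.smul_eq_C_mul, map_smul, Matrix.trace_smul]
    simp
  rw [hL]
  push_cast
  rw [Finset.mul_sum, Finset.mul_sum, ← Finset.sum_add_distrib]
  refine Finset.sum_congr rfl fun m _ => ?_
  rcases m with _ | n
  · simp [kmMom]
    field_simp
  · have := cheb_trace N hN φ hφ n
    rw [if_neg (by omega)]
    linear_combination (a (n + 1) : ℂ) * this
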